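/- Let E and F be complex Banach spaces, let T₀ > 0 be a real number, let (λ_j)_{j∈ℕ} and (μ_j)_{j∈ℕ} be sequences of positive real numbers tending to ∞, and let (P_j)_{j∈ℕ} and (Q_j)_{j∈ℕ} be ℓ¹-bounded families of bounded linear operators from E to F (each with some constant). Suppose that for every real t ∈ (0, T₀) one has ∑_{j∈ℕ} e^{-λ_j(T₀-t)} P_j = ∑_{j∈ℕ} e^{-μ_j(T₀-t)} Q_j (equality of sums in operator norm). Then ∑_{j∈ℕ} e^{-λ_j(T₀-τ)} P_j = ∑_{j∈ℕ} e^{-μ_j(T₀-τ)} Q_j for every complex number τ with Re τ < T₀. -/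

import Mathlib

open Filter Topology

/-- An `ℓ¹`-bounded family of operators, multiplied by scalars tending to zero, is summable in
operator norm. -/
theorem summable_smul_of_l1_bounded {E F : Type*} [NormedAddCommGroup E] [NormedSpace ℂ E]
    [NormedAddCommGroup F] [NormedSpace ℂ F] [CompleteSpace F]
    {P : ℕ → E →L[ℂ] F} {C : ℝ} (hsum : ∀ x : E, Summable fun j => ‖P j x‖)
    (hbound : ∀ x : E, ∑' j, ‖P j x‖ ≤ C * ‖x‖) {c : ℕ → ℂ} (hc : Tendsto c atTop (𝓝 0)) :
    Summable fun j => c j • P j := by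
  rw [summable_iff_vanishing_norm]
  intro ε hε
  have hD : 0 < |C| + 1 := by positivity
  obtain ⟨N, hN⟩ := (Metric.tendsto_atTop.1 hc) (ε / 2 / (|C| + 1)) (by positivity)
  refine ⟨Finset.range N, fun t ht => ?_⟩
  refine lt_of_le_of_lt (ContinuousLinearMap.opNorm_le_bound _ (half_pos hε).le fun x => ?_)
    (half_lt_self hε)
  have hcj : ∀ j ∈ t, ‖c j‖ ≤ ε / 2 / (|C| + 1) := fun j hj => by
    have hNj : N ≤ j := by
      by_contra! h
      exact Finset.disjoint_left.1 ht hj (Finset.mem_range.2 h)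
    simpa using (hN j hNj).le
  calc ‖(∑ j ∈ t, c j • P j) x‖ = ‖∑ j ∈ t, c j • P j x‖ := by
        simp
    _ ≤ ∑ j ∈ t, ε / 2 / (|C| + 1) * ‖P j x‖ :=
        norm_sum_le_of_le _ fun j hj => by
          rw [norm_smul]
          exact mul_le_mul_of_nonneg_right (hcj j hj) (norm_nonneg _)
    _ = ε / 2 / (|C| + 1) * ∑ j ∈ t, ‖P j x‖ := by rw [Finset.mul_sum]
    _ ≤ ε / 2 / (|C| + 1) * ((|C| + 1) * ‖x‖) := by
        gcongr
        calc ∑ j ∈ t, ‖P j x‖ ≤ ∑' j, ‖P j x‖ :=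
              (hsum x).sum_le_tsum t fun _ _ => norm_nonneg _
          _ ≤ C * ‖x‖ := hbound x
          _ ≤ (|C| + 1) * ‖x‖ := by
              gcongr
              linarith [le_abs_self C]
    _ = ε / 2 * ‖x‖ := by field_simp

theorem norm_exp_neg_mul_sub (a T : ℝ) (τ : ℂ) :
    ‖Complex.exp (-(a : ℂ) * ((T : ℂ) - τ))‖ = Real.exp (-(a * (T - τ.re))) := by
  simp [Complex.norm_exp]

theorem tsum_exp_smul_apply {E F : Type*} [NormedAddCommGroup E] [NormedSpace ℂ E]
    [NormedAddCommGroup F] [NormedSpace ℂ F] [CompleteSpace F]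
    {P : ℕ → E →L[ℂ] F} {C : ℝ} (hsum : ∀ x : E, Summable fun j => ‖P j x‖)
    (hbound : ∀ x : E, ∑' j, ‖P j x‖ ≤ C * ‖x‖) {lam : ℕ → ℝ} (hlam : Tendsto lam atTop atTop)
    {T : ℝ} {τ : ℂ} (hτ : τ.re < T) (x : E) :
    (∑' j, Complex.exp (-(lam j : ℂ) * ((T : ℂ) - τ)) • P j) x
      = ∑' j, Complex.exp (-(lam j : ℂ) * ((T : ℂ) - τ)) • P j x := by
  have hc : Tendsto (fun j => Complex.exp (-(lam j : ℂ) * ((T : ℂ) - τ))) atTop (𝓝 0) := by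
    rw [tendsto_zero_iff_norm_tendsto_zero]
    simp only [norm_exp_neg_mul_sub]
    exact Real.tendsto_exp_neg_atTop_nhds_zero.comp (hlam.atTop_mul_const (sub_pos.2 hτ))
  have h := (ContinuousLinearMap.apply ℂ F x).map_tsum (summable_smul_of_l1_bounded hsum hbound hc)
  simpa using h

theorem isOpen_re_lt (T : ℝ) : IsOpen {τ : ℂ | τ.re < T} :=
  isOpen_lt Complex.continuous_re continuous_const

theorem analyticOnNhd_tsum_exp_smul {F : Type*} [NormedAddCommGroup F] [NormedSpace ℂ F]
    [CompleteSpace F] {v : ℕ → F} (hv : Summable fun j => ‖v j‖) {lam : ℕ → ℝ}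
    (hlam : ∀ j, 0 < lam j) (T : ℝ) :
    AnalyticOnNhd ℂ (fun τ : ℂ => ∑' j, Complex.exp (-(lam j : ℂ) * ((T : ℂ) - τ)) • v j)
      {τ : ℂ | τ.re < T} := by
  refine DifferentiableOn.analyticOnNhd ?_ (isOpen_re_lt T)
  refine Complex.differentiableOn_tsum_of_summable_norm hv (fun j => by fun_prop)
    (isOpen_re_lt T) fun j τ hτ => ?_
  rw [norm_smul, norm_exp_neg_mul_sub]
  refine mul_le_of_le_one_left (norm_nonneg _) (Real.exp_le_one_iff.2 ?_)
  have := mul_pos (hlam j) (sub_pos.2 (show τ.re < T from hτ))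
  linarith

open Filter Topology

/-- If two exponential operator series with ℓ¹-bounded
coefficient families agree for all real times `t ∈ (0, T₀)`, then they agree
for all complex `τ` with `Re τ < T₀`. -/
theorem stmt_1 {E F : Type*} [NormedAddCommGroup E] [NormedSpace ℂ E]
    [NormedAddCommGroup F] [NormedSpace ℂ F] [CompleteSpace F]
    (T₀ : ℝ) (hT₀ : 0 < T₀)
    (lam mu : ℕ → ℝ) (hlam : ∀ j, 0 < lam j) (hmu : ∀ j, 0 < mu j)
    (hlamlim : Tendsto lam atTop atTop) (hmulim : Tendsto mu atTop atTop)
    (P Q : ℕ → E →L[ℂ] F) (C₁ C₂ : ℝ)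
    (hPsum : ∀ x : E, Summable fun j => ‖P j x‖)
    (hPbound : ∀ x : E, ∑' j, ‖P j x‖ ≤ C₁ * ‖x‖)
    (hQsum : ∀ x : E, Summable fun j => ‖Q j x‖)
    (hQbound : ∀ x : E, ∑' j, ‖Q j x‖ ≤ C₂ * ‖x‖)
    (heq : ∀ t : ℝ, 0 < t → t < T₀ →
      ∑' j, Complex.exp (-(lam j : ℂ) * ((T₀ : ℂ) - (t : ℂ))) • P j
        = ∑' j, Complex.exp (-(mu j : ℂ) * ((T₀ : ℂ) - (t : ℂ))) • Q j) :
    ∀ τ : ℂ, τ.re < T₀ →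
      ∑' j, Complex.exp (-(lam j : ℂ) * ((T₀ : ℂ) - τ)) • P j
        = ∑' j, Complex.exp (-(mu j : ℂ) * ((T₀ : ℂ) - τ)) • Q j := by
  intro τ hτ
  ext x
  rw [tsum_exp_smul_apply hPsum hPbound hlamlim hτ, tsum_exp_smul_apply hQsum hQbound hmulim hτ]
  have hmid : (((T₀ / 2 : ℝ) : ℂ)).re < T₀ := by
    rw [Complex.ofReal_re]
    linarith
  refine (analyticOnNhd_tsum_exp_smul (hPsum x) hlam T₀).eqOn_of_preconnected_of_frequently_eq
    (analyticOnNhd_tsum_exp_smul (hQsum x) hmu T₀)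
    (convex_halfSpace_re_lt T₀).isPreconnected hmid ?_ hτ
  have htend : Tendsto (fun t : ℝ => (t : ℂ)) (𝓝[≠] (T₀ / 2)) (𝓝[≠] ((T₀ / 2 : ℝ) : ℂ)) :=
    Complex.continuous_ofReal.continuousWithinAt.tendsto_nhdsWithin fun t ht h =>
      ht (Complex.ofReal_injective h)
  refine htend.frequently (Eventually.frequently ?_)
  have hIoo : Set.Ioo 0 T₀ ∈ 𝓝[≠] (T₀ / 2) :=
    mem_nhdsWithin_of_mem_nhds (Ioo_mem_nhds (by linarith) (by linarith))
  filter_upwards [hIoo] with t ht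
  have ht' : ((t : ℂ)).re < T₀ := by simpa using ht.2
  rw [← tsum_exp_smul_apply hPsum hPbound hlamlim ht',
    ← tsum_exp_smul_apply hQsum hQbound hmulim ht', heq t ht.1 ht.2]
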